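/- Let p and p' be compositions of n into m parts that are rearrangements of each other (they determine the same partition of n). Then Σ_{T ∈ 𝒯_p} q^{w(T)} = Σ_{T ∈ 𝒯_{p'}} q^{w(T)} as polynomials in q, where 𝒯_p denotes the set of properly tiered trees on {1,…,n} of tier type p. -/

import Mathlib

open scoped Classical

/-- Reachability along a finite edge set (edges are unordered pairs of naturals). -/
def EReach (E : Finset (Sym2 ℕ)) : ℕ → ℕ → Prop :=
  Relation.ReflTransGen fun a b => s(a, b) ∈ E

/-- `E` is the edge set of a tree on the vertex set `V`: all edges join distinct
vertices of `V`, any two vertices of `V` are joined by a walk, and the number of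
edges is one less than the number of vertices. -/
def IsTreeOn (V : Finset ℕ) (E : Finset (Sym2 ℕ)) : Prop :=
  (∀ e ∈ E, ∀ x ∈ e, x ∈ V) ∧ (∀ e ∈ E, ¬ e.IsDiag) ∧
    (∀ a ∈ V, ∀ b ∈ V, EReach E a b) ∧ E.card + 1 = V.card

/-- `t` is a tiering function (with tiers `1, …, m`) for the graph with vertex set `V`
and edge set `E`: tiers lie in `{1, …, m}` and if `a < b` are adjacent then `t a < t b`. -/
def IsTieredOn (V : Finset ℕ) (E : Finset (Sym2 ℕ)) (m : ℕ) (t : ℕ → ℕ) : Prop :=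
  (∀ v ∈ V, t v ∈ Finset.Icc 1 m) ∧ ∀ a b : ℕ, s(a, b) ∈ E → a < b → t a < t b

/-- Auxiliary fuelled recursion computing the weight of a tiered tree: delete the
minimal vertex `v`, and sum, over the components `C` of the resulting forest
(one for each neighbour `u` of `v`), the weight of the component plus the number
of vertices `x ∈ C` with `t x > t v` and `x < u`.  (Fuel `V.card` always suffices,
since components are strictly smaller.) -/
noncomputable def treeWeightAux (t : ℕ → ℕ) : ℕ → Finset ℕ → Finset (Sym2 ℕ) → ℕ
  | 0, _, _ => 0
  | fuel + 1, V, E =>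
    if h : 2 ≤ V.card then
      let v := V.min' (Finset.card_pos.mp (by omega))
      let E' := E.filter fun e => v ∉ e
      ((V.erase v).filter fun u => s(v, u) ∈ E).sum fun u =>
        let C := (V.erase v).filter fun x => EReach E' u x
        (C.filter fun x => t v < t x ∧ x < u).card +
          treeWeightAux t fuel C (E'.filter fun e => ∀ x ∈ e, x ∈ C)
    else 0

/-- The weight of a tiered tree with vertex set `V`, edge set `E` and tiering function `t`. -/
noncomputable def treeWeight (V : Finset ℕ) (E : Finset (Sym2 ℕ)) (t : ℕ → ℕ) : ℕ :=
  treeWeightAux t V.card V E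

/-- The number of vertices of `{1,…,n}` on tier `k`. -/
noncomputable def tierSize (n : ℕ) (t : ℕ → ℕ) (k : ℕ) : ℕ :=
  ((Finset.Icc 1 n).filter fun v => t v = k).card

/-- The set of (properly) tiered trees on `{1,…,n}` of tier type `p` (a composition of
`n` into `m` parts, indexed so that tier `k+1` has `p k` vertices), encoded as pairs
`(E, t)` of an edge set and a tiering function, normalised to vanish off `{1,…,n}`. -/
def TieredTreesOfType (n m : ℕ) (p : Fin m → ℕ) : Set (Finset (Sym2 ℕ) × (ℕ → ℕ)) :=
  {T | IsTreeOn (Finset.Icc 1 n) T.1 ∧ IsTieredOn (Finset.Icc 1 n) T.1 m T.2 ∧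
    (∀ x, x ∉ Finset.Icc 1 n → T.2 x = 0) ∧
    ∀ k : Fin m, tierSize n T.2 ((k : ℕ) + 1) = p k}

/-! ### Reachability and trees -/

theorem EReach.symm {E : Finset (Sym2 ℕ)} {a b : ℕ} (h : EReach E a b) : EReach E b a := by
  have : Std.Symm fun a b => s(a, b) ∈ E := ⟨fun x y hxy => by rwa [Sym2.eq_swap]⟩
  exact Std.Symm.symm (r := Relation.ReflTransGen fun a b => s(a, b) ∈ E) _ _ h

theorem EReach.mono {E F : Finset (Sym2 ℕ)} (hEF : E ⊆ F) {a b : ℕ} (h : EReach E a b) :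
    EReach F a b :=
  Relation.ReflTransGen.mono (fun _ _ hxy => hEF hxy) _ _ h

theorem EReach.trans {E : Finset (Sym2 ℕ)} {a b c : ℕ} (h : EReach E a b) (h' : EReach E b c) :
    EReach E a c :=
  Relation.ReflTransGen.trans h h'

theorem EReach.of_mem {E : Finset (Sym2 ℕ)} {a b : ℕ} (h : s(a, b) ∈ E) : EReach E a b :=
  Relation.ReflTransGen.single h

/-- A set containing the starting point and closed under adjacency contains everything
reachable. -/
theorem EReach.mem_of_closed {E : Finset (Sym2 ℕ)} {S : Set ℕ}
    (hS : ∀ x y, s(x, y) ∈ E → x ∈ S → y ∈ S) {a b : ℕ} (h : EReach E a b) (ha : a ∈ S) :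
    b ∈ S := by
  induction h with
  | refl => exact ha
  | tail _ hbc ih => exact hS _ _ hbc ih

/-- If all walks of `E` starting in `S` use only edges of `F`, then reachability in `E` from a
point of `S` implies reachability in `F`. -/
theorem EReach.of_closed {E F : Finset (Sym2 ℕ)} {S : Set ℕ}
    (hS : ∀ x y, s(x, y) ∈ E → x ∈ S → y ∈ S ∧ s(x, y) ∈ F) {a b : ℕ} (h : EReach E a b)
    (ha : a ∈ S) : EReach F a b := by
  have : b ∈ S ∧ EReach F a b := by
    induction h with
    | refl => exact ⟨ha, Relation.ReflTransGen.refl⟩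
    | tail _ hbc ih =>
      obtain ⟨h1, h2⟩ := hS _ _ hbc ih.1
      exact ⟨h1, ih.2.tail h2⟩
  exact this.2

/-- A walk leaving `S` uses an edge leaving `S`. -/
theorem EReach.exists_crossing {E : Finset (Sym2 ℕ)} {S : Set ℕ} {a b : ℕ} (h : EReach E a b)
    (ha : a ∈ S) (hb : b ∉ S) : ∃ x y, s(x, y) ∈ E ∧ x ∈ S ∧ y ∉ S := by
  by_contra! hcon
  exact hb (h.mem_of_closed hcon ha)

/-- A connected graph has at least as many edges as vertices, minus one. -/
theorem card_le_card_edges_add_one {V : Finset ℕ} {E : Finset (Sym2 ℕ)}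
    (hE : ∀ e ∈ E, ∀ x ∈ e, x ∈ V) (hconn : ∀ a ∈ V, ∀ b ∈ V, EReach E a b) :
    V.card ≤ E.card + 1 := by
  have grow : ∀ k < V.card, ∃ S ⊆ V, S.card = k + 1 ∧
      k ≤ (E.filter fun e => ∀ x ∈ e, x ∈ S).card := by
    intro k
    induction k with
    | zero =>
      intro hk
      obtain ⟨r, hr⟩ := Finset.card_pos.mp hk
      exact ⟨{r}, by simpa using hr, by simp, by simp⟩
    | succ k ih =>
      intro hk
      obtain ⟨S, hSV, hS, hcard⟩ := ih (by omega)
      obtain ⟨a, ha⟩ : S.Nonempty := Finset.card_pos.mp (by omega)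
      obtain ⟨b, hbV, hb⟩ := Finset.exists_mem_notMem_of_card_lt_card (show S.card < V.card by omega)
      obtain ⟨x, y, hxy, hx, hy⟩ :=
        (hconn a (hSV ha) b hbV).exists_crossing (S := (S : Set ℕ)) ha hb
      simp only [Finset.mem_coe] at hx hy
      have hyV : y ∈ V := hE _ hxy y (by simp)
      refine ⟨insert y S, Finset.insert_subset hyV hSV, by simp [hy, hS], ?_⟩
      have hsub : insert s(x, y) (E.filter fun e => ∀ z ∈ e, z ∈ S) ⊆
          E.filter fun e => ∀ z ∈ e, z ∈ insert y S := by
        intro e he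
        rw [Finset.mem_insert] at he
        rcases he with rfl | he
        · simp [hxy, hx]
        · simp only [Finset.mem_filter] at he ⊢
          exact ⟨he.1, fun z hz => Finset.mem_insert_of_mem (he.2 z hz)⟩
      have := Finset.card_le_card hsub
      rw [Finset.card_insert_of_notMem (by simp [hy])] at this
      omega
  rcases Nat.eq_zero_or_pos V.card with h | h
  · omega
  · obtain ⟨S, -, -, hcard⟩ := grow (V.card - 1) (by omega)
    have := Finset.card_filter_le E (fun e => ∀ x ∈ e, x ∈ S)
    omega

/-- The component of `r` after deletion of the vertex `v`. -/
noncomputable def branch (V : Finset ℕ) (E : Finset (Sym2 ℕ)) (v r : ℕ) : Finset ℕ :=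
  (V.erase v).filter fun x => EReach (E.filter fun e => v ∉ e) r x

/-- The edges of `E` with both ends in `S`. -/
noncomputable def edgesIn (E : Finset (Sym2 ℕ)) (S : Finset ℕ) : Finset (Sym2 ℕ) :=
  E.filter fun e => ∀ x ∈ e, x ∈ S

theorem mem_edgesIn {E : Finset (Sym2 ℕ)} {S : Finset ℕ} {e : Sym2 ℕ} :
    e ∈ edgesIn E S ↔ e ∈ E ∧ ∀ x ∈ e, x ∈ S := by
  simp [edgesIn]

theorem mk_mem_edgesIn {E : Finset (Sym2 ℕ)} {S : Finset ℕ} {a b : ℕ} :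
    s(a, b) ∈ edgesIn E S ↔ s(a, b) ∈ E ∧ a ∈ S ∧ b ∈ S := by
  simp [edgesIn]

/-- `E` is obtained by joining a connected graph on `D` and a graph on `V \ D`
by the single edge from `v ∈ V \ D` to `u ∈ D`. -/
structure IsGlued (V D : Finset ℕ) (v u : ℕ) (E E₁ E₂ : Finset (Sym2 ℕ)) : Prop where
  sub : D ⊆ V
  hv : v ∈ V
  hvD : v ∉ D
  hu : u ∈ D
  hE₁ : ∀ e ∈ E₁, ∀ x ∈ e, x ∈ D
  hE₂ : ∀ e ∈ E₂, ∀ x ∈ e, x ∈ V \ D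
  conn : ∀ a ∈ D, ∀ b ∈ D, EReach E₁ a b
  eq : E = insert s(v, u) (E₁ ∪ E₂)

namespace IsGlued

variable {V D : Finset ℕ} {v u : ℕ} {E E₁ E₂ : Finset (Sym2 ℕ)}

theorem mk_mem₁ (h : IsGlued V D v u E E₁ E₂) {a b : ℕ} (hab : s(a, b) ∈ E₁) :
    a ∈ D ∧ b ∈ D :=
  ⟨h.hE₁ _ hab a (by simp), h.hE₁ _ hab b (by simp)⟩

theorem mk_mem₂ (h : IsGlued V D v u E E₁ E₂) {a b : ℕ} (hab : s(a, b) ∈ E₂) :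
    (a ∈ V ∧ a ∉ D) ∧ b ∈ V ∧ b ∉ D :=
  ⟨by simpa using h.hE₂ _ hab a (by simp), by simpa using h.hE₂ _ hab b (by simp)⟩

theorem mk_mem (h : IsGlued V D v u E E₁ E₂) {a b : ℕ} :
    s(a, b) ∈ E ↔ (a = v ∧ b = u ∨ a = u ∧ b = v) ∨ s(a, b) ∈ E₁ ∨ s(a, b) ∈ E₂ := by
  rw [h.eq]; simp

theorem edgesIn_left (h : IsGlued V D v u E E₁ E₂) : edgesIn E D = E₁ := by
  ext e
  induction e with | _ a b
  rw [mk_mem_edgesIn, h.mk_mem]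
  have h1 := h.mk_mem₁ (a := a) (b := b)
  have h2 := h.mk_mem₂ (a := a) (b := b)
  have := h.hvD
  grind

theorem edgesIn_right (h : IsGlued V D v u E E₁ E₂) : edgesIn E (V \ D) = E₂ := by
  ext e
  induction e with | _ a b
  rw [mk_mem_edgesIn, h.mk_mem]
  have h1 := h.mk_mem₁ (a := a) (b := b)
  have h2 := h.mk_mem₂ (a := a) (b := b)
  have := h.hu
  grind

theorem neighbour_eq (h : IsGlued V D v u E E₁ E₂) {x : ℕ} (hx : x ∈ D) :
    s(v, x) ∈ E ↔ x = u := by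
  rw [h.mk_mem]
  have h1 := h.mk_mem₁ (a := v) (b := x)
  have h2 := h.mk_mem₂ (a := v) (b := x)
  have := h.hvD
  grind

theorem branch_left (h : IsGlued V D v u E E₁ E₂) {w : ℕ} (hw : w ∈ D) :
    branch V E v w = D := by
  have hvD := h.hvD
  ext x
  simp only [branch, Finset.mem_filter, Finset.mem_erase]
  constructor
  · rintro ⟨-, hx⟩
    refine hx.mem_of_closed (S := (D : Set ℕ)) (fun y z hyz hy => ?_) hw
    simp only [Finset.mem_filter, h.mk_mem, Sym2.mem_iff, Finset.mem_coe] at hyz hy ⊢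
    have h1 := h.mk_mem₁ (a := y) (b := z)
    have h2 := h.mk_mem₂ (a := y) (b := z)
    grind
  · intro hx
    refine ⟨⟨fun h' => hvD (h' ▸ hx), h.sub hx⟩, (h.conn w hw x hx).mono fun e he => ?_⟩
    rw [Finset.mem_filter, h.eq]
    exact ⟨by simp [he], fun hve => hvD (h.hE₁ _ he v hve)⟩

theorem branch_right (h : IsGlued V D v u E E₁ E₂) {w : ℕ} (hw : w ∈ V \ D) :
    branch V E v w = branch (V \ D) E₂ v w := by
  have hvD := h.hvD
  have key : ∀ y z, s(y, z) ∈ E.filter (fun e => v ∉ e) → y ∈ ((V \ D : Finset ℕ) : Set ℕ) →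
      z ∈ ((V \ D : Finset ℕ) : Set ℕ) ∧ s(y, z) ∈ E₂.filter fun e => v ∉ e := by
    intro y z hyz hy
    simp only [Finset.mem_filter, h.mk_mem, Sym2.mem_iff, Finset.mem_coe, Finset.mem_sdiff]
      at hyz hy ⊢
    have h1 := h.mk_mem₁ (a := y) (b := z)
    have h2 := h.mk_mem₂ (a := y) (b := z)
    grind
  ext x
  simp only [branch, Finset.mem_filter, Finset.mem_erase]
  constructor
  · rintro ⟨⟨hxv, -⟩, hx⟩
    exact ⟨⟨hxv, hx.mem_of_closed (fun y z hyz hy => (key y z hyz hy).1) hw⟩,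
      hx.of_closed key hw⟩
  · rintro ⟨⟨hxv, hxD⟩, hx⟩
    refine ⟨⟨hxv, (Finset.mem_sdiff.mp hxD).1⟩, hx.mono ?_⟩
    refine Finset.filter_subset_filter _ fun e he => ?_
    rw [h.eq]; simp [he]

end IsGlued

/-! ### The weight of a glued tree -/

theorem branch_subset_erase {V : Finset ℕ} {E : Finset (Sym2 ℕ)} {v u : ℕ} :
    branch V E v u ⊆ V.erase v :=
  Finset.filter_subset _ _

theorem edgesIn_filter_notMem {E : Finset (Sym2 ℕ)} {S : Finset ℕ} {v : ℕ} (hv : v ∉ S) :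
    ((E.filter fun e => v ∉ e).filter fun e => ∀ x ∈ e, x ∈ S) = edgesIn E S := by
  ext e
  simp only [Finset.mem_filter, mem_edgesIn]
  exact ⟨fun h => ⟨h.1.1, h.2⟩, fun h => ⟨⟨h.1, fun hve => hv (h.2 v hve)⟩, h.2⟩⟩

theorem treeWeightAux_succ {t : ℕ → ℕ} {V : Finset ℕ} {E : Finset (Sym2 ℕ)} {v : ℕ} (f : ℕ)
    (h2 : 2 ≤ V.card) (hv : v ∈ V) (hmin : ∀ x ∈ V, v ≤ x) :
    treeWeightAux t (f + 1) V E = ∑ u ∈ (V.erase v).filter (fun u => s(v, u) ∈ E),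
      (((branch V E v u).filter fun x => t v < t x ∧ x < u).card +
        treeWeightAux t f (branch V E v u) (edgesIn E (branch V E v u))) := by
  have hV : V.Nonempty := ⟨v, hv⟩
  have hm : V.min' hV = v := le_antisymm (V.min'_le v hv) (hmin _ (V.min'_mem hV))
  rw [treeWeightAux, dif_pos h2]
  simp only [hm]
  refine Finset.sum_congr rfl fun u _ => ?_
  rw [← edgesIn_filter_notMem (v := v) fun h => by simpa using branch_subset_erase h]
  rfl

theorem treeWeightAux_of_card_lt_two {t : ℕ → ℕ} {V : Finset ℕ} {E : Finset (Sym2 ℕ)} (f : ℕ)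
    (h : V.card < 2) : treeWeightAux t f V E = 0 := by
  cases f with
  | zero => rfl
  | succ f => rw [treeWeightAux, dif_neg (by omega)]

theorem exists_min {V : Finset ℕ} (h : V.Nonempty) : ∃ v ∈ V, ∀ x ∈ V, v ≤ x :=
  ⟨V.min' h, V.min'_mem h, fun x hx => V.min'_le x hx⟩

theorem treeWeightAux_eq_treeWeight {t : ℕ → ℕ} {f : ℕ} {V : Finset ℕ} {E : Finset (Sym2 ℕ)}
    (hf : V.card ≤ f) : treeWeightAux t f V E = treeWeight V E t := by
  suffices H : ∀ f g : ℕ, ∀ V : Finset ℕ, ∀ E, V.card ≤ f → V.card ≤ g →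
      treeWeightAux t f V E = treeWeightAux t g V E from H f _ V E hf le_rfl
  intro f
  induction f with
  | zero =>
    intro g V E h _
    rw [treeWeightAux_of_card_lt_two _ (by omega), treeWeightAux_of_card_lt_two _ (by omega)]
  | succ f ih =>
    intro g V E hf hg
    rcases lt_or_ge V.card 2 with h | h
    · rw [treeWeightAux_of_card_lt_two _ h, treeWeightAux_of_card_lt_two _ h]
    · obtain ⟨g, rfl⟩ : ∃ g', g = g' + 1 := ⟨g - 1, by omega⟩
      obtain ⟨v, hv, hmin⟩ := exists_min (Finset.card_pos.mp (by omega : 0 < V.card))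
      rw [treeWeightAux_succ f h hv hmin, treeWeightAux_succ g h hv hmin]
      refine Finset.sum_congr rfl fun u _ => ?_
      have hc : (branch V E v u).card + 1 ≤ V.card := by
        rw [← Finset.card_erase_add_one hv]
        exact Nat.succ_le_succ (Finset.card_le_card branch_subset_erase)
      rw [ih g _ _ (by omega) (by omega)]

theorem treeWeight_eq_sum {t : ℕ → ℕ} {V : Finset ℕ} {E : Finset (Sym2 ℕ)} {v : ℕ}
    (hdiag : ∀ e ∈ E, ¬ e.IsDiag) (hv : v ∈ V) (hmin : ∀ x ∈ V, v ≤ x) :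
    treeWeight V E t = ∑ u ∈ V.filter (fun u => s(v, u) ∈ E),
      (((branch V E v u).filter fun x => t v < t x ∧ x < u).card +
        treeWeight (branch V E v u) (edgesIn E (branch V E v u)) t) := by
  have herase : V.filter (fun u => s(v, u) ∈ E) = (V.erase v).filter fun u => s(v, u) ∈ E := by
    ext u
    simp only [Finset.mem_filter, Finset.mem_erase]
    refine ⟨fun h => ⟨⟨?_, h.1⟩, h.2⟩, fun h => ⟨h.1.2, h.2⟩⟩
    rintro rfl
    exact hdiag _ h.2 (by simp)
  rw [herase]
  rcases lt_or_ge V.card 2 with h | h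
  · have : V.erase v = ∅ := by
      rw [← Finset.card_eq_zero, Finset.card_erase_of_mem hv]; omega
    rw [this, treeWeight, treeWeightAux_of_card_lt_two _ h]
    simp
  · rw [← treeWeightAux_eq_treeWeight (Nat.le_succ _), treeWeightAux_succ _ h hv hmin]
    refine Finset.sum_congr rfl fun u _ => ?_
    rw [treeWeightAux_eq_treeWeight]
    exact Finset.card_le_card (branch_subset_erase.trans (Finset.erase_subset _ _))

theorem treeWeight_congr {t t' : ℕ → ℕ} {V : Finset ℕ} (h : ∀ x ∈ V, t x = t' x)
    (E : Finset (Sym2 ℕ)) : treeWeight V E t = treeWeight V E t' := by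
  have H : ∀ f : ℕ, ∀ V : Finset ℕ, ∀ E, (∀ x ∈ V, t x = t' x) →
      treeWeightAux t f V E = treeWeightAux t' f V E := by
    intro f
    induction f with
    | zero => intros; rfl
    | succ f ih =>
      intro V E h
      rcases lt_or_ge V.card 2 with h2 | h2
      · rw [treeWeightAux_of_card_lt_two _ h2, treeWeightAux_of_card_lt_two _ h2]
      · obtain ⟨v, hv, hmin⟩ := exists_min (Finset.card_pos.mp (by omega : 0 < V.card))
        rw [treeWeightAux_succ f h2 hv hmin, treeWeightAux_succ f h2 hv hmin]
        refine Finset.sum_congr rfl fun u _ => ?_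
        have hsub : ∀ x ∈ branch V E v u, t x = t' x :=
          fun x hx => h x (Finset.mem_of_mem_erase (branch_subset_erase hx))
        rw [ih _ _ hsub]
        congr 2
        refine Finset.filter_congr fun x hx => ?_
        rw [hsub x hx, h v hv]
  exact H _ V E h

theorem edgesIn_edgesIn {E : Finset (Sym2 ℕ)} {S S' : Finset ℕ} (h : S ⊆ S') :
    edgesIn (edgesIn E S') S = edgesIn E S := by
  ext e
  simp only [mem_edgesIn]
  exact ⟨fun he => ⟨he.1.1, he.2⟩, fun he => ⟨⟨he.1, fun x hx => h (he.2 x hx)⟩, he.2⟩⟩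

theorem IsGlued.treeWeight_eq {V D : Finset ℕ} {v u : ℕ} {E E₁ E₂ : Finset (Sym2 ℕ)}
    (h : IsGlued V D v u E E₁ E₂) (t : ℕ → ℕ) (hmin : ∀ x ∈ V, v ≤ x)
    (hdiag : ∀ e ∈ E, ¬ e.IsDiag) :
    treeWeight V E t = (D.filter fun x => t v < t x ∧ x < u).card + treeWeight D E₁ t +
      treeWeight (V \ D) E₂ t := by
  have hE₂E : E₂ ⊆ E := by rw [h.eq]; intro e he; simp [he]
  have hsplit : V.filter (fun x => s(v, x) ∈ E) =
      insert u ((V \ D).filter fun x => s(v, x) ∈ E₂) := by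
    ext x
    have h2 := h.mk_mem₂ (a := v) (b := x)
    have h1 := h.mk_mem₁ (a := v) (b := x)
    have hu := h.hu
    have huV := h.sub h.hu
    have hvD := h.hvD
    simp only [Finset.mem_filter, Finset.mem_insert, Finset.mem_sdiff, h.mk_mem]
    grind
  rw [treeWeight_eq_sum hdiag h.hv hmin, hsplit, Finset.sum_insert (by simp [h.hu]),
    h.branch_left h.hu, h.edgesIn_left,
    treeWeight_eq_sum (V := V \ D) (v := v) (fun e he => hdiag e (hE₂E he))
      (by simp [h.hv, h.hvD]) (fun x hx => hmin x (Finset.mem_sdiff.mp hx).1)]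
  congr 1
  refine Finset.sum_congr rfl fun x hx => ?_
  rw [h.branch_right (Finset.mem_filter.mp hx).1]
  congr 2
  rw [← h.edgesIn_right, edgesIn_edgesIn]
  exact branch_subset_erase.trans (Finset.erase_subset _ _)

/-! ### Decomposition of tiered trees -/

/-- The trees on `V` for which `t` is increasing along edges. -/
noncomputable def tieredTrees (V : Finset ℕ) (t : ℕ → ℕ) : Finset (Finset (Sym2 ℕ)) :=
  V.sym2.powerset.filter fun E =>
    IsTreeOn V E ∧ ∀ a b : ℕ, s(a, b) ∈ E → a < b → t a < t b

theorem mem_tieredTrees {V : Finset ℕ} {t : ℕ → ℕ} {E : Finset (Sym2 ℕ)} :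
    E ∈ tieredTrees V t ↔ IsTreeOn V E ∧ ∀ a b : ℕ, s(a, b) ∈ E → a < b → t a < t b := by
  rw [tieredTrees, Finset.mem_filter, Finset.mem_powerset, and_iff_right_iff_imp]
  intro h e he
  exact Finset.mem_sym2_iff.mpr (h.1.1 e he)

theorem isGlued_insert {V D : Finset ℕ} {v u : ℕ} {t : ℕ → ℕ} {E₁ E₂ : Finset (Sym2 ℕ)}
    (hD : D ⊆ V) (hv : v ∈ V) (hvD : v ∉ D) (hu : u ∈ D)
    (h₁ : E₁ ∈ tieredTrees D t) (h₂ : E₂ ∈ tieredTrees (V \ D) t) :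
    IsGlued V D v u (insert s(v, u) (E₁ ∪ E₂)) E₁ E₂ := by
  rw [mem_tieredTrees] at h₁ h₂
  exact ⟨hD, hv, hvD, hu, h₁.1.1, h₂.1.1, h₁.1.2.2.1, rfl⟩

theorem insert_mem_tieredTrees {V D : Finset ℕ} {v u : ℕ} {t : ℕ → ℕ} {E₁ E₂ : Finset (Sym2 ℕ)}
    (hD : D ⊆ V) (hv : v ∈ V) (hvD : v ∉ D) (hu : u ∈ D) (hmin : ∀ x ∈ V, v ≤ x)
    (htu : t v < t u) (h₁ : E₁ ∈ tieredTrees D t) (h₂ : E₂ ∈ tieredTrees (V \ D) t) :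
    insert s(v, u) (E₁ ∪ E₂) ∈ tieredTrees V t := by
  have hg := isGlued_insert hD hv hvD hu h₁ h₂
  rw [mem_tieredTrees] at h₁ h₂ ⊢
  obtain ⟨⟨hE₁, hd₁, hc₁, hn₁⟩, ht₁⟩ := h₁
  obtain ⟨⟨hE₂, hd₂, hc₂, hn₂⟩, ht₂⟩ := h₂
  have hvu : v < u := lt_of_le_of_ne (hmin u (hD hu)) fun h => hvD (h ▸ hu)
  refine ⟨⟨?_, ?_, ?_, ?_⟩, ?_⟩
  · intro e he x hx
    rw [Finset.mem_insert, Finset.mem_union] at he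
    rcases he with rfl | he | he
    · rcases Sym2.mem_iff.mp hx with rfl | rfl
      exacts [hv, hD hu]
    · exact hD (hE₁ e he x hx)
    · exact (Finset.mem_sdiff.mp (hE₂ e he x hx)).1
  · intro e he
    rw [Finset.mem_insert, Finset.mem_union] at he
    rcases he with rfl | he | he
    · simpa using hvu.ne
    · exact hd₁ e he
    · exact hd₂ e he
  · have hroot : ∀ a ∈ V, EReach (insert s(v, u) (E₁ ∪ E₂)) v a := by
      intro a ha
      by_cases haD : a ∈ D
      · exact (EReach.of_mem (by simp)).trans
          ((hc₁ u hu a haD).mono fun e he => by simp [he])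
      · exact (hc₂ v (by simp [hv, hvD]) a (by simp [ha, haD])).mono fun e he => by simp [he]
    exact fun a ha b hb => (hroot a ha).symm.trans (hroot b hb)
  · have hdisj : Disjoint E₁ E₂ := by
      rw [Finset.disjoint_left]
      intro e he he'
      induction e with | _ a b
      exact (hg.mk_mem₂ he').1.2 (hg.mk_mem₁ he).1
    have hnot : s(v, u) ∉ E₁ ∪ E₂ := by
      rw [Finset.mem_union]
      rintro (h | h)
      · exact hvD (hg.mk_mem₁ h).1
      · exact (hg.mk_mem₂ h).2.2 hu
    rw [Finset.card_insert_of_notMem hnot, Finset.card_union_of_disjoint hdisj]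
    have := Finset.card_sdiff_add_card_eq_card hD
    omega
  · intro a b hab hlt
    rcases hg.mk_mem.mp hab with (⟨rfl, rfl⟩ | ⟨rfl, rfl⟩) | h | h
    · exact htu
    · omega
    · exact ht₁ a b h hlt
    · exact ht₂ a b h hlt

theorem edgesIn_mem_tieredTrees {V S : Finset ℕ} {t : ℕ → ℕ} {E : Finset (Sym2 ℕ)}
    (hE : E ∈ tieredTrees V t) (hconn : ∀ a ∈ S, ∀ b ∈ S, EReach (edgesIn E S) a b)
    (hcard : (edgesIn E S).card + 1 = S.card) : edgesIn E S ∈ tieredTrees S t := by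
  rw [mem_tieredTrees] at hE ⊢
  exact ⟨⟨fun e he => (mem_edgesIn.mp he).2, fun e he => hE.1.2.1 e (mem_edgesIn.mp he).1,
    hconn, hcard⟩, fun a b hab => hE.2 a b (mem_edgesIn.mp hab).1⟩

theorem exists_isGlued {V : Finset ℕ} {v w : ℕ} {t : ℕ → ℕ} {E : Finset (Sym2 ℕ)}
    (hE : E ∈ tieredTrees V t) (hv : v ∈ V) (hmin : ∀ x ∈ V, v ≤ x) (hw : w ∈ V.erase v)
    {D : Finset ℕ} (hD : branch V E v w = D) :
    ∃ u ∈ D, t v < t u ∧ edgesIn E D ∈ tieredTrees D t ∧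
      edgesIn E (V \ D) ∈ tieredTrees (V \ D) t ∧
      E = insert s(v, u) (edgesIn E D ∪ edgesIn E (V \ D)) := by
  obtain ⟨⟨hEV, hdiag, hconn, hcard⟩, ht⟩ := mem_tieredTrees.mp hE
  have hDV : D ⊆ V := hD ▸ branch_subset_erase.trans (Finset.erase_subset _ _)
  have hvD : v ∉ D := fun h => by
    rw [← hD] at h
    exact Finset.notMem_erase v V (branch_subset_erase h)
  have hwD : w ∈ D := by
    rw [← hD, branch, Finset.mem_filter]; exact ⟨hw, Relation.ReflTransGen.refl⟩
  have hclosed : ∀ x y, s(x, y) ∈ E → x ∈ D → y ≠ v → y ∈ D := by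
    intro x y hxy hx hy
    have hxv : x ≠ v := fun h => hvD (h ▸ hx)
    rw [← hD, branch, Finset.mem_filter] at hx ⊢
    refine ⟨Finset.mem_erase.mpr ⟨hy, hEV _ hxy y (by simp)⟩, hx.2.trans (EReach.of_mem ?_)⟩
    simp [hxy, hxv.symm, hy.symm]
  have hroot₁ : ∀ a ∈ D, EReach (edgesIn E D) w a := by
    intro a ha
    rw [← hD, branch, Finset.mem_filter] at ha
    refine ha.2.of_closed (S := (D : Set ℕ)) (fun x y hxy hx => ?_) hwD
    simp only [Finset.mem_filter, Sym2.mem_iff, not_or, Finset.mem_coe] at hxy hx ⊢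
    have := hclosed x y hxy.1 hx (fun h => hxy.2.2 h.symm)
    exact ⟨this, mk_mem_edgesIn.mpr ⟨hxy.1, hx, this⟩⟩
  have hroot₂ : ∀ a ∈ V \ D, EReach (edgesIn E (V \ D)) v a := by
    intro a ha
    rw [Finset.mem_sdiff] at ha
    have : a ∈ {x | x ∈ D ∨ EReach (edgesIn E (V \ D)) v x} := by
      refine (hconn v hv a ha.1).mem_of_closed (fun x y hxy hx => ?_)
        (Or.inr Relation.ReflTransGen.refl)
      by_cases hyD : y ∈ D
      · exact Or.inl hyD
      right
      by_cases hyv : y = v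
      · subst hyv; exact Relation.ReflTransGen.refl
      have hxD : x ∉ D := fun hxD => hyD (hclosed x y hxy hxD hyv)
      refine (hx.resolve_left hxD).trans (EReach.of_mem (mk_mem_edgesIn.mpr ⟨hxy, ?_, ?_⟩))
      · exact Finset.mem_sdiff.mpr ⟨hEV _ hxy x (by simp), hxD⟩
      · exact Finset.mem_sdiff.mpr ⟨hEV _ hxy y (by simp), hyD⟩
    exact this.resolve_left ha.2
  have hconn₁ : ∀ a ∈ D, ∀ b ∈ D, EReach (edgesIn E D) a b :=
    fun a ha b hb => (hroot₁ a ha).symm.trans (hroot₁ b hb)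
  have hconn₂ : ∀ a ∈ V \ D, ∀ b ∈ V \ D, EReach (edgesIn E (V \ D)) a b :=
    fun a ha b hb => (hroot₂ a ha).symm.trans (hroot₂ b hb)
  obtain ⟨x, u, hxu, hxD, huD⟩ := (hconn v hv w (hDV hwD)).exists_crossing
    (S := {x | x ∉ D}) hvD (by simpa using hwD)
  simp only [Set.mem_ofPred_eq, not_not] at hxD huD
  have hxv : x = v := by
    by_contra hxv
    exact hxD (hclosed u x (by rwa [Sym2.eq_swap]) huD hxv)
  subst hxv
  have hc₁ := card_le_card_edges_add_one (fun e he => (mem_edgesIn.mp he).2) hconn₁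
  have hc₂ := card_le_card_edges_add_one (fun e he => (mem_edgesIn.mp he).2) hconn₂
  have hdisj : Disjoint (edgesIn E D) (edgesIn E (V \ D)) := by
    rw [Finset.disjoint_left]
    intro e he he'
    induction e with | _ a b
    rw [mk_mem_edgesIn] at he he'
    exact (Finset.mem_sdiff.mp he'.2.1).2 he.2.1
  have hnot : s(x, u) ∉ edgesIn E D ∪ edgesIn E (V \ D) := by
    simp [mk_mem_edgesIn, huD, hvD]
  have hsub : insert s(x, u) (edgesIn E D ∪ edgesIn E (V \ D)) ⊆ E := by
    intro e he
    rw [Finset.mem_insert, Finset.mem_union] at he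
    rcases he with rfl | he | he
    · exact hxu
    · exact (mem_edgesIn.mp he).1
    · exact (mem_edgesIn.mp he).1
  have hcardins : (insert s(x, u) (edgesIn E D ∪ edgesIn E (V \ D))).card =
      (edgesIn E D).card + (edgesIn E (V \ D)).card + 1 := by
    rw [Finset.card_insert_of_notMem hnot, Finset.card_union_of_disjoint hdisj]
  have hle := Finset.card_le_card hsub
  have hVD := Finset.card_sdiff_add_card_eq_card hDV
  have hlt : x < u := lt_of_le_of_ne (hmin u (hDV huD)) fun h => hxD (h ▸ huD)
  exact ⟨u, huD, ht x u hxu hlt,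
    edgesIn_mem_tieredTrees hE hconn₁ (by omega), edgesIn_mem_tieredTrees hE hconn₂ (by omega),
    (Finset.eq_of_subset_of_card_le hsub (by omega)).symm⟩

/-! ### The weight enumerator of the trees with a fixed tiering function -/

open Polynomial in
/-- The weight enumerator of the tiered trees on `V` with tiering function `t`. -/
noncomputable def treePoly (V : Finset ℕ) (t : ℕ → ℕ) : ℤ[X] :=
  ∑ E ∈ tieredTrees V t, X ^ treeWeight V E t

open Polynomial in
/-- The `q`-analogue `1 + q + ⋯ + q ^ (k - 1)` of `k`. -/
noncomputable def qNat (k : ℕ) : ℤ[X] :=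
  ∑ j ∈ Finset.range k, X ^ j

open Polynomial in
theorem sum_pow_card_filter_lt (S : Finset ℕ) :
    ∑ u ∈ S, (X : ℤ[X]) ^ (S.filter fun x => x < u).card = qNat S.card := by
  induction S using Finset.induction_on_max with
  | empty => simp [qNat]
  | insert a S ha ih =>
    have haS : a ∉ S := fun h => lt_irrefl _ (ha a h)
    rw [Finset.sum_insert haS, Finset.card_insert_of_notMem haS, qNat, Finset.sum_range_succ,
      ← qNat, ← ih, add_comm]
    congr 1
    · refine Finset.sum_congr rfl fun u hu => ?_
      rw [Finset.filter_insert, if_neg (by have := ha u hu; omega)]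
    · rw [Finset.filter_insert, if_neg (lt_irrefl _), Finset.filter_true_of_mem ha]

/-- The number of vertices of `S` on a higher tier than `v`. -/
noncomputable def upDeg (t : ℕ → ℕ) (v : ℕ) (S : Finset ℕ) : ℕ :=
  (S.filter fun x => t v < t x).card

open Polynomial in
theorem sum_filter_branch_eq {V D : Finset ℕ} {v w : ℕ} (t : ℕ → ℕ) (hv : v ∈ V)
    (hmin : ∀ x ∈ V, v ≤ x) (hw : w ∈ D) (hD : D ⊆ V.erase v) :
    ∑ E ∈ (tieredTrees V t).filter (fun E => branch V E v w = D),
      (X : ℤ[X]) ^ treeWeight V E t =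
        treePoly D t * qNat (upDeg t v D) * treePoly (V \ D) t := by
  have hDV : D ⊆ V := hD.trans (Finset.erase_subset _ _)
  have hvD : v ∉ D := fun h => by simpa using hD h
  rw [upDeg, ← sum_pow_card_filter_lt, treePoly, treePoly, Finset.sum_mul_sum,
    ← Finset.sum_product', Finset.sum_mul_sum, ← Finset.sum_product']
  symm
  refine Finset.sum_bij (fun z _ => insert s(v, z.1.2) (z.1.1 ∪ z.2)) ?_ ?_ ?_ ?_
  · rintro ⟨⟨E₁, u⟩, E₂⟩ hz
    simp only [Finset.mem_product, Finset.mem_filter] at hz ⊢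
    obtain ⟨⟨h₁, hu, htu⟩, h₂⟩ := hz
    exact ⟨insert_mem_tieredTrees hDV hv hvD hu hmin htu h₁ h₂,
      (isGlued_insert hDV hv hvD hu h₁ h₂).branch_left hw⟩
  · rintro ⟨⟨E₁, u⟩, E₂⟩ hz ⟨⟨E₁', u'⟩, E₂'⟩ hz' heq
    simp only [Finset.mem_product, Finset.mem_filter] at hz hz' heq
    obtain ⟨⟨h₁, hu, -⟩, h₂⟩ := hz
    obtain ⟨⟨h₁', hu', -⟩, h₂'⟩ := hz'
    have g := isGlued_insert hDV hv hvD hu h₁ h₂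
    have g' := isGlued_insert hDV hv hvD hu' h₁' h₂'
    rw [← heq] at g'
    rw [g.edgesIn_left.symm.trans g'.edgesIn_left, g.edgesIn_right.symm.trans g'.edgesIn_right,
      (g'.neighbour_eq hu).mp ((g.neighbour_eq hu).mpr rfl)]
  · intro E hE
    rw [Finset.mem_filter] at hE
    obtain ⟨u, hu, htu, h₁, h₂, heq⟩ := exists_isGlued hE.1 hv hmin (hD hw) hE.2
    exact ⟨((edgesIn E D, u), edgesIn E (V \ D)), by simp [h₁, h₂, hu, htu], heq.symm⟩
  · rintro ⟨⟨E₁, u⟩, E₂⟩ hz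
    simp only [Finset.mem_product, Finset.mem_filter] at hz
    obtain ⟨⟨h₁, hu, htu⟩, h₂⟩ := hz
    rw [(isGlued_insert hDV hv hvD hu h₁ h₂).treeWeight_eq t hmin
      (mem_tieredTrees.mp (insert_mem_tieredTrees hDV hv hvD hu hmin htu h₁ h₂)).1.2.1,
      Finset.filter_filter, pow_add, pow_add]
    ring

/-- The subsets of `V` containing `v`. -/
def rootedSubsets (V : Finset ℕ) (v : ℕ) : Finset (Finset ℕ) :=
  V.powerset.filter (v ∈ ·)

theorem mem_rootedSubsets {V C : Finset ℕ} {v : ℕ} : C ∈ rootedSubsets V v ↔ C ⊆ V ∧ v ∈ C := by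
  simp [rootedSubsets]

/-- Splitting a tree along the component of `w` after deletion of the minimal vertex `v`. -/
theorem treePoly_eq_sum {V : Finset ℕ} {v w : ℕ} (t : ℕ → ℕ) (hv : v ∈ V)
    (hmin : ∀ x ∈ V, v ≤ x) (hw : w ∈ V.erase v) :
    treePoly V t = ∑ D ∈ rootedSubsets (V.erase v) w,
      treePoly D t * qNat (upDeg t v D) * treePoly (V \ D) t := by
  rw [treePoly, ← Finset.sum_fiberwise_of_maps_to
    (s := tieredTrees V t) (t := rootedSubsets (V.erase v) w)
    (g := fun E => branch V E v w)]
  · refine Finset.sum_congr rfl fun D hD => ?_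
    rw [mem_rootedSubsets] at hD
    exact sum_filter_branch_eq t hv hmin hD.2 hD.1
  · intro E _
    rw [mem_rootedSubsets]
    refine ⟨branch_subset_erase, ?_⟩
    rw [branch, Finset.mem_filter]
    exact ⟨hw, Relation.ReflTransGen.refl⟩

theorem treePoly_singleton (v : ℕ) (t : ℕ → ℕ) : treePoly {v} t = 1 := by
  have : tieredTrees {v} t = {∅} := by
    ext E
    rw [mem_tieredTrees, Finset.mem_singleton]
    constructor
    · intro h
      simpa using h.1.2.2.2
    · rintro rfl
      refine ⟨⟨by simp, by simp, ?_, by simp⟩, by simp⟩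
      simp only [Finset.mem_singleton]
      rintro _ rfl _ rfl
      exact Relation.ReflTransGen.refl
  rw [treePoly, this, Finset.sum_singleton, treeWeight, treeWeightAux_of_card_lt_two _ (by simp)]
  simp

theorem treePoly_congr {V : Finset ℕ} {t t' : ℕ → ℕ} (h : ∀ x ∈ V, t x = t' x) :
    treePoly V t = treePoly V t' := by
  have : tieredTrees V t = tieredTrees V t' := by
    ext E
    rw [mem_tieredTrees, mem_tieredTrees]
    refine and_congr_right fun hE => forall₂_congr fun a b => forall_congr' fun hab => ?_
    rw [h a (hE.1 _ hab a (by simp)), h b (hE.1 _ hab b (by simp))]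
  rw [treePoly, treePoly, this]
  exact Finset.sum_congr rfl fun E _ => by rw [treeWeight_congr h]

/-! ### From increasing pairs to trees -/

/-- The number of pairs `a < b` in `V` with `t a < t b`. -/
noncomputable def upPairs (V : Finset ℕ) (t : ℕ → ℕ) : ℕ :=
  ((V ×ˢ V).filter fun z => z.1 < z.2 ∧ t z.1 < t z.2).card

theorem upPairs_congr {V : Finset ℕ} {t t' : ℕ → ℕ} (h : ∀ x ∈ V, t x = t' x) :
    upPairs V t = upPairs V t' := by
  rw [upPairs, upPairs]
  congr 1
  refine Finset.filter_congr fun z hz => ?_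
  rw [Finset.mem_product] at hz
  rw [h _ hz.1, h _ hz.2]

theorem upPairs_eq_upDeg_add {V : Finset ℕ} {v : ℕ} (t : ℕ → ℕ) (hv : v ∈ V)
    (hmin : ∀ x ∈ V, v ≤ x) : upPairs V t = upDeg t v (V.erase v) + upPairs (V.erase v) t := by
  have hsplit : (V ×ˢ V).filter (fun z => z.1 < z.2 ∧ t z.1 < t z.2) =
      ((V.erase v).filter fun x => t v < t x).image (fun x => (v, x)) ∪
        (V.erase v ×ˢ V.erase v).filter fun z => z.1 < z.2 ∧ t z.1 < t z.2 := by
    ext ⟨a, b⟩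
    have ha := hmin a
    have hb := hmin b
    simp only [Finset.mem_filter, Finset.mem_product, Finset.mem_union, Finset.mem_image,
      Finset.mem_erase, Prod.mk.injEq]
    grind
  rw [upPairs, hsplit, Finset.card_union_of_disjoint, Finset.card_image_of_injective, upDeg,
    upPairs]
  · exact fun x y h => (Prod.mk.inj h).2
  · rw [Finset.disjoint_left]
    rintro ⟨a, b⟩ h h'
    simp only [Finset.mem_filter, Finset.mem_product, Finset.mem_image, Finset.mem_erase,
      Prod.mk.injEq] at h h'
    grind

theorem upPairs_insert {V : Finset ℕ} {v : ℕ} (t : ℕ → ℕ) (hmax : ∀ x ∈ V, x < v) :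
    upPairs (insert v V) t = upPairs V t + (V.filter fun x => t x < t v).card := by
  have hsplit : (insert v V ×ˢ insert v V).filter (fun z => z.1 < z.2 ∧ t z.1 < t z.2) =
      (V ×ˢ V).filter (fun z => z.1 < z.2 ∧ t z.1 < t z.2) ∪
        (V.filter fun x => t x < t v).image fun x => (x, v) := by
    ext ⟨a, b⟩
    have ha := hmax a
    have hb := hmax b
    simp only [Finset.mem_filter, Finset.mem_product, Finset.mem_union, Finset.mem_image,
      Finset.mem_insert, Prod.mk.injEq]
    grind
  rw [upPairs, hsplit, Finset.card_union_of_disjoint, Finset.card_image_of_injective, upPairs]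
  · exact fun x y h => (Prod.mk.inj h).1
  · rw [Finset.disjoint_left]
    rintro ⟨a, b⟩ h h'
    have hb := hmax b
    simp only [Finset.mem_filter, Finset.mem_product, Finset.mem_image, Prod.mk.injEq] at h h'
    grind

theorem upDeg_union {t : ℕ → ℕ} {v : ℕ} {S S' : Finset ℕ} (h : Disjoint S S') :
    upDeg t v (S ∪ S') = upDeg t v S + upDeg t v S' := by
  rw [upDeg, Finset.filter_union, Finset.card_union_of_disjoint]
  · rfl
  · exact Finset.disjoint_filter_filter h

open Polynomial in
theorem X_sub_one_mul_qNat (k : ℕ) : (X - 1 : ℤ[X]) * qNat k = X ^ k - 1 :=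
  mul_geom_sum X k

theorem sum_rootedSubsets_swap {R : Type*} [AddCommMonoid R] {V : Finset ℕ} {v w : ℕ}
    (f : Finset ℕ → Finset ℕ → R) :
    ∑ C ∈ (rootedSubsets V v).filter (w ∉ ·), ∑ D ∈ rootedSubsets (V \ C) w, f C D =
      ∑ D ∈ rootedSubsets (V.erase v) w, ∑ C ∈ rootedSubsets (V \ D) v, f C D := by
  refine Finset.sum_comm' fun C D => ?_
  simp only [Finset.mem_filter, mem_rootedSubsets, Finset.subset_sdiff, Finset.subset_erase]
  have h := Finset.disjoint_left (s := C) (t := D)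
  rw [disjoint_comm (a := D)]
  constructor
  · rintro ⟨⟨⟨hC, hv⟩, -⟩, ⟨hD, hdisj⟩, hw⟩
    exact ⟨⟨⟨hC, hdisj⟩, hv⟩, ⟨hD, h.mp hdisj hv⟩, hw⟩
  · rintro ⟨⟨⟨hC, hdisj⟩, hv⟩, ⟨hD, -⟩, hw⟩
    exact ⟨⟨⟨hC, hv⟩, fun hwC => h.mp hdisj hwC hw⟩, ⟨hD, hdisj⟩, hw⟩

theorem sum_rootedSubsets_sdiff {R : Type*} [AddCommMonoid R] {V : Finset ℕ} {v w : ℕ}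
    (f : Finset ℕ → Finset ℕ → R) :
    ∑ C ∈ (rootedSubsets V v).filter (w ∈ ·), ∑ D ∈ rootedSubsets (C.erase v) w, f (C \ D) D =
      ∑ D ∈ rootedSubsets (V.erase v) w, ∑ C ∈ rootedSubsets (V \ D) v, f C D := by
  rw [Finset.sum_sigma', Finset.sum_sigma']
  refine Finset.sum_bij' (fun z _ => ⟨z.2, z.1 \ z.2⟩) (fun z _ => ⟨z.2 ∪ z.1, z.1⟩) ?_ ?_ ?_ ?_ ?_
  · rintro ⟨C, D⟩ h
    simp only [Finset.mem_sigma, Finset.mem_filter, mem_rootedSubsets, Finset.subset_erase] at h ⊢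
    obtain ⟨⟨⟨hC, hv⟩, hwC⟩, ⟨hD, hvD⟩, hw⟩ := h
    exact ⟨⟨⟨hD.trans hC, hvD⟩, hw⟩, Finset.sdiff_subset_sdiff hC subset_rfl,
      Finset.mem_sdiff.mpr ⟨hv, hvD⟩⟩
  · rintro ⟨D, C⟩ h
    simp only [Finset.mem_sigma, Finset.mem_filter, mem_rootedSubsets, Finset.subset_erase,
      Finset.subset_sdiff] at h ⊢
    obtain ⟨⟨⟨hD, hvD⟩, hw⟩, ⟨hC, hdisj⟩, hv⟩ := h
    exact ⟨⟨⟨Finset.union_subset hC hD, Finset.mem_union_left _ hv⟩, Finset.mem_union_right _ hw⟩,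
      ⟨Finset.subset_union_right, hvD⟩, hw⟩
  · rintro ⟨C, D⟩ h
    simp only [Finset.mem_sigma, Finset.mem_filter, mem_rootedSubsets, Finset.subset_erase] at h
    simp [Finset.sdiff_union_of_subset h.2.1.1]
  · rintro ⟨D, C⟩ h
    simp only [Finset.mem_sigma, mem_rootedSubsets, Finset.subset_sdiff] at h
    simp [Finset.union_sdiff_cancel_right h.2.1.2]
  · rintro ⟨C, D⟩ _
    rfl

open Polynomial in
/-- The exponential formula for the graphs of increasing pairs: `q` to the number of increasing
pairs is a sum over the component of the minimal vertex. -/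
theorem X_pow_upPairs_eq_sum (t : ℕ → ℕ) (V : Finset ℕ) {v : ℕ} (hv : v ∈ V)
    (hmin : ∀ x ∈ V, v ≤ x) :
    (X : ℤ[X]) ^ upPairs V t = ∑ C ∈ rootedSubsets V v,
      (X - 1) ^ (C.card - 1) * treePoly C t * X ^ upPairs (V \ C) t := by
  induction V using Finset.strongInduction generalizing v with
  | H V ih =>
  rcases (V.erase v).eq_empty_or_nonempty with hV | hV
  · obtain rfl : V = {v} := by
      rw [Finset.erase_eq_empty_iff] at hV
      exact hV.resolve_left (Finset.ne_empty_of_mem hv)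
    have : rootedSubsets {v} v = {{v}} := by
      ext C
      rw [mem_rootedSubsets, Finset.mem_singleton]
      exact ⟨fun h => h.1.antisymm (by simpa using h.2), by rintro rfl; simp⟩
    rw [this, Finset.sum_singleton, treePoly_singleton, upPairs_eq_upDeg_add t hv hmin]
    simp [upDeg]
  obtain ⟨w, hw, hwmin⟩ := exists_min hV
  have hwV := Finset.mem_of_mem_erase hw
  have hwv := Finset.ne_of_mem_erase hw
  -- the two halves of the sum, according to whether `w` lies in the component of `v`
  have hout : ∑ C ∈ (rootedSubsets V v).filter (w ∉ ·),
      (X - 1 : ℤ[X]) ^ (C.card - 1) * treePoly C t * X ^ upPairs (V \ C) t =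
      ∑ D ∈ rootedSubsets (V.erase v) w, (X - 1) ^ (D.card - 1) * treePoly D t *
        X ^ upPairs (V \ D) t := by
    calc _ = ∑ C ∈ (rootedSubsets V v).filter (w ∉ ·), ∑ D ∈ rootedSubsets (V \ C) w,
          (X - 1 : ℤ[X]) ^ (C.card - 1) * treePoly C t *
            ((X - 1) ^ (D.card - 1) * treePoly D t * X ^ upPairs ((V \ C) \ D) t) := by
          refine Finset.sum_congr rfl fun C hC => ?_
          simp only [Finset.mem_filter, mem_rootedSubsets] at hC
          rw [← Finset.mul_sum, ← ih (V \ C)]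
          · exact Finset.sdiff_ssubset hC.1.1 ⟨v, hC.1.2⟩
          · simp [hwV, hC.2]
          · intro x hx
            rw [Finset.mem_sdiff] at hx
            exact hwmin x (Finset.mem_erase.mpr ⟨fun h => hx.2 (h ▸ hC.1.2), hx.1⟩)
      _ = ∑ D ∈ rootedSubsets (V.erase v) w, ∑ C ∈ rootedSubsets (V \ D) v,
          (X - 1 : ℤ[X]) ^ (C.card - 1) * treePoly C t *
            ((X - 1) ^ (D.card - 1) * treePoly D t * X ^ upPairs ((V \ C) \ D) t) :=
          sum_rootedSubsets_swap _
      _ = _ := by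
          refine Finset.sum_congr rfl fun D hD => ?_
          rw [mem_rootedSubsets, Finset.subset_erase] at hD
          rw [ih (V \ D) (Finset.sdiff_ssubset hD.1.1 ⟨w, hD.2⟩) (v := v) (by simp [hv, hD.1.2])
            (fun x hx => hmin x (Finset.mem_sdiff.mp hx).1), Finset.mul_sum]
          refine Finset.sum_congr rfl fun C _ => ?_
          rw [sdiff_right_comm]
          ring
  have hin : ∑ C ∈ (rootedSubsets V v).filter (w ∈ ·),
      (X - 1 : ℤ[X]) ^ (C.card - 1) * treePoly C t * X ^ upPairs (V \ C) t =
      ∑ D ∈ rootedSubsets (V.erase v) w, (X - 1) ^ (D.card - 1) * treePoly D t *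
        (X ^ upDeg t v D - 1) * X ^ upPairs (V \ D) t := by
    calc _ = ∑ C ∈ (rootedSubsets V v).filter (w ∈ ·), ∑ D ∈ rootedSubsets (C.erase v) w,
          (X - 1 : ℤ[X]) ^ ((C \ D).card - 1) * (X - 1) ^ (D.card - 1) * (X ^ upDeg t v D - 1) *
            (treePoly D t * treePoly (C \ D) t) * X ^ upPairs (V \ ((C \ D) ∪ D)) t := by
          refine Finset.sum_congr rfl fun C hC => ?_
          simp only [Finset.mem_filter, mem_rootedSubsets] at hC
          rw [treePoly_eq_sum (w := w) t hC.1.2 (fun x hx => hmin x (hC.1.1 hx))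
            (by simp [hC.2, hwv]), Finset.mul_sum, Finset.sum_mul]
          refine Finset.sum_congr rfl fun D hD => ?_
          rw [mem_rootedSubsets, Finset.subset_erase] at hD
          have h1 := Finset.card_pos.mpr ⟨w, hD.2⟩
          have h2 : 0 < (C \ D).card := Finset.card_pos.mpr ⟨v, by simp [hC.1.2, hD.1.2]⟩
          have h3 := Finset.card_sdiff_add_card_eq_card hD.1.1
          rw [show C.card - 1 = ((C \ D).card - 1) + (D.card - 1) + 1 by omega, pow_add, pow_succ,
            ← X_sub_one_mul_qNat, Finset.sdiff_union_of_subset hD.1.1]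
          ring
      _ = ∑ D ∈ rootedSubsets (V.erase v) w, ∑ C ∈ rootedSubsets (V \ D) v,
          (X - 1 : ℤ[X]) ^ (C.card - 1) * (X - 1) ^ (D.card - 1) * (X ^ upDeg t v D - 1) *
            (treePoly D t * treePoly C t) * X ^ upPairs (V \ (C ∪ D)) t :=
          sum_rootedSubsets_sdiff fun C D => (X - 1 : ℤ[X]) ^ (C.card - 1) *
            (X - 1) ^ (D.card - 1) * (X ^ upDeg t v D - 1) *
            (treePoly D t * treePoly C t) * X ^ upPairs (V \ (C ∪ D)) t
      _ = _ := by
          refine Finset.sum_congr rfl fun D hD => ?_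
          rw [mem_rootedSubsets, Finset.subset_erase] at hD
          rw [ih (V \ D) (Finset.sdiff_ssubset hD.1.1 ⟨w, hD.2⟩) (v := v) (by simp [hv, hD.1.2])
            (fun x hx => hmin x (Finset.mem_sdiff.mp hx).1), Finset.mul_sum]
          refine Finset.sum_congr rfl fun C _ => ?_
          rw [Finset.union_comm, show V \ (D ∪ C) = (V \ D) \ C from sdiff_sdiff_left.symm]
          ring
  rw [← Finset.sum_filter_add_sum_filter_not _ (w ∈ ·), hout, hin, ← Finset.sum_add_distrib,
    upPairs_eq_upDeg_add t hv hmin, pow_add, ih (V.erase v) (Finset.erase_ssubset hv) hw hwmin,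
    Finset.mul_sum]
  refine Finset.sum_congr rfl fun D hD => ?_
  rw [mem_rootedSubsets, Finset.subset_erase] at hD
  have hvVD : v ∈ V \ D := by simp [hv, hD.1.2]
  rw [upPairs_eq_upDeg_add t hvVD (fun x hx => hmin x (Finset.mem_sdiff.mp hx).1),
    ← Finset.erase_sdiff_comm]
  have hdeg : upDeg t v (V.erase v) = upDeg t v D + upDeg t v (V.erase v \ D) := by
    rw [← upDeg_union Finset.disjoint_sdiff, Finset.union_sdiff_of_subset]
    exact Finset.subset_erase.mpr hD.1
  rw [hdeg, pow_add, pow_add]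
  ring

/-! ### Sums over tiering functions -/

/-- The functions `V → {1, …, m}`, extended by zero. -/
noncomputable def tierings (m : ℕ) (V : Finset ℕ) : Finset (ℕ → ℕ) :=
  (V.pi fun _ => Finset.Icc 1 m).image fun f x => if h : x ∈ V then f x h else 0

theorem mem_tierings {m : ℕ} {V : Finset ℕ} {t : ℕ → ℕ} :
    t ∈ tierings m V ↔ (∀ x ∈ V, t x ∈ Finset.Icc 1 m) ∧ ∀ x, x ∉ V → t x = 0 := by
  simp only [tierings, Finset.mem_image, Finset.mem_pi]
  constructor
  · rintro ⟨f, hf, rfl⟩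
    exact ⟨fun x hx => by simpa [hx] using hf x hx, fun x hx => by simp [hx]⟩
  · rintro ⟨h, h0⟩
    refine ⟨fun x _ => t x, h, funext fun x => ?_⟩
    by_cases hx : x ∈ V
    · simp [hx]
    · simp [hx, h0 x hx]

theorem tierings_empty (m : ℕ) : tierings m ∅ = {0} := by
  ext t
  rw [mem_tierings, Finset.mem_singleton, funext_iff]
  simp

theorem sum_tierings_mul {R : Type*} [CommSemiring R] {m : ℕ} {V C : Finset ℕ} (hC : C ⊆ V)
    {g h : (ℕ → ℕ) → R} (hg : ∀ t t' : ℕ → ℕ, (∀ x ∈ C, t x = t' x) → g t = g t')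
    (hh : ∀ t t' : ℕ → ℕ, (∀ x ∈ V \ C, t x = t' x) → h t = h t') :
    ∑ t ∈ tierings m V, g t * h t =
      (∑ t ∈ tierings m C, g t) * ∑ t ∈ tierings m (V \ C), h t := by
  rw [Finset.sum_mul_sum, ← Finset.sum_product']
  refine Finset.sum_bij'
    (fun t _ => ((fun x => if x ∈ C then t x else 0), fun x => if x ∈ V \ C then t x else 0))
    (fun z _ x => if x ∈ C then z.1 x else z.2 x) ?_ ?_ ?_ ?_ ?_
  · intro t ht
    rw [mem_tierings] at ht
    rw [Finset.mem_product, mem_tierings, mem_tierings]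
    refine ⟨⟨fun x hx => ?_, fun x hx => if_neg hx⟩, fun x hx => ?_, fun x hx => if_neg hx⟩
    · simpa only [if_pos hx] using ht.1 x (hC hx)
    · simpa only [if_pos hx] using ht.1 x (Finset.mem_sdiff.mp hx).1
  · rintro ⟨t₁, t₂⟩ hz
    rw [Finset.mem_product, mem_tierings, mem_tierings] at hz
    rw [mem_tierings]
    constructor
    · intro x hx
      by_cases hxC : x ∈ C
      · simpa only [if_pos hxC] using hz.1.1 x hxC
      · simpa only [if_neg hxC] using hz.2.1 x (Finset.mem_sdiff.mpr ⟨hx, hxC⟩)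
    · intro x hx
      rw [if_neg fun hxC => hx (hC hxC)]
      exact hz.2.2 x fun h' => hx (Finset.mem_sdiff.mp h').1
  · intro t ht
    rw [mem_tierings] at ht
    funext x
    have := ht.2 x
    by_cases hxC : x ∈ C <;> by_cases hx : x ∈ V <;> simp_all
  · rintro ⟨t₁, t₂⟩ hz
    rw [Finset.mem_product, mem_tierings, mem_tierings] at hz
    refine Prod.ext (funext fun x => ?_) (funext fun x => ?_)
    · have := hz.1.2 x
      by_cases hxC : x ∈ C <;> simp_all
    · have := hz.2.2 x
      by_cases hxC : x ∈ C <;> by_cases hx : x ∈ V <;> simp_all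
  · intro t _
    exact congrArg₂ _ (hg _ _ fun x hx => (if_pos hx).symm) (hh _ _ fun x hx => (if_pos hx).symm)

theorem sum_tierings_insert {M : Type*} [AddCommMonoid M] {m : ℕ} {V : Finset ℕ} {v : ℕ}
    (hv : v ∉ V) (f : (ℕ → ℕ) → M) :
    ∑ t ∈ tierings m (insert v V), f t =
      ∑ k ∈ Finset.Icc 1 m, ∑ t ∈ tierings m V, f (Function.update t v k) := by
  rw [← Finset.sum_product']
  symm
  refine Finset.sum_bij' (fun z _ => Function.update z.2 v z.1)
    (fun t _ => (t v, Function.update t v 0)) ?_ ?_ ?_ ?_ ?_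
  · rintro ⟨k, t⟩ hz
    rw [Finset.mem_product, mem_tierings] at hz
    rw [mem_tierings]
    obtain ⟨hk, ht, h0⟩ := hz
    constructor
    · intro x hx
      rcases eq_or_ne x v with rfl | hxv
      · simpa using hk
      · simpa [hxv] using ht x ((Finset.mem_insert.mp hx).resolve_left hxv)
    · intro x hx
      rw [Finset.mem_insert, not_or] at hx
      simpa [hx.1] using h0 x hx.2
  · intro t ht
    rw [mem_tierings] at ht
    rw [Finset.mem_product, mem_tierings]
    refine ⟨ht.1 v (by simp), fun x hx => ?_, fun x hx => ?_⟩
    · have hxv : x ≠ v := fun h => hv (h ▸ hx)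
      simpa [hxv] using ht.1 x (by simp [hx])
    · rcases eq_or_ne x v with rfl | hxv
      · simp
      · simpa [hxv] using ht.2 x (by simp [hx, hxv])
  · rintro ⟨k, t⟩ hz
    rw [Finset.mem_product, mem_tierings] at hz
    have : Function.update t v 0 = t := by
      rw [Function.update_eq_self_iff]; exact (hz.2.2 v hv).symm
    simp [this]
  · intro t _
    simp
  · intro z _
    rfl

/-- The number of vertices of `V` on each tier. -/
noncomputable def tierContent (V : Finset ℕ) (t : ℕ → ℕ) : ℕ →₀ ℕ :=
  ∑ x ∈ V, Finsupp.single (t x) 1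

theorem tierContent_apply (V : Finset ℕ) (t : ℕ → ℕ) (k : ℕ) :
    tierContent V t k = (V.filter fun x => t x = k).card := by
  rw [tierContent, Finsupp.finsetSum_apply, Finset.card_filter]
  exact Finset.sum_congr rfl fun x _ => Finsupp.single_apply

theorem tierContent_congr {V : Finset ℕ} {t t' : ℕ → ℕ} (h : ∀ x ∈ V, t x = t' x) :
    tierContent V t = tierContent V t' :=
  Finset.sum_congr rfl fun x hx => by rw [h x hx]

theorem sum_tierContent {m : ℕ} {V : Finset ℕ} {t : ℕ → ℕ} (ht : t ∈ tierings m V) :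
    ∑ k ∈ Finset.Icc 1 m, tierContent V t k = V.card := by
  simp only [tierContent_apply]
  exact (Finset.card_eq_sum_card_fiberwise (mem_tierings.mp ht).1).symm

theorem tierContent_eq_zero {m : ℕ} {V : Finset ℕ} {t : ℕ → ℕ} (ht : t ∈ tierings m V) {k : ℕ}
    (hk : k ∉ Finset.Icc 1 m) : tierContent V t k = 0 := by
  rw [tierContent_apply, Finset.card_eq_zero, Finset.filter_eq_empty_iff]
  rintro x hx rfl
  exact hk ((mem_tierings.mp ht).1 x hx)

theorem card_filter_lt_eq_sum_tierContent {m : ℕ} {V : Finset ℕ} {t : ℕ → ℕ}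
    (ht : t ∈ tierings m V) (k : ℕ) :
    (V.filter fun x => t x < k).card = ∑ j ∈ Finset.Ico 1 k, tierContent V t j := by
  rw [Finset.card_eq_sum_card_fiberwise (f := t) (t := Finset.Ico 1 k)]
  · refine Finset.sum_congr rfl fun j hj => ?_
    rw [tierContent_apply, Finset.filter_filter]
    congr 1
    refine Finset.filter_congr fun x _ => ?_
    have := (Finset.mem_Ico.mp hj).2
    omega
  · intro x hx
    have hx := Finset.mem_filter.mp (Finset.mem_coe.mp hx)
    have := Finset.mem_Icc.mp ((mem_tierings.mp ht).1 x hx.1)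
    simp only [Finset.coe_Ico, Set.mem_Ico]
    omega

/-! ### Increasing pairs of words with given content -/

open Polynomial in
theorem qNat_add (a b : ℕ) : qNat (a + b) = qNat a + X ^ a * qNat b := by
  rw [qNat, Finset.sum_range_add, qNat, qNat, Finset.mul_sum]
  simp only [pow_add]

theorem qNat_succ_ne_zero (k : ℕ) : qNat (k + 1) ≠ 0 := by
  intro h
  have := congrArg (Polynomial.eval 1) h
  simp [qNat, Polynomial.eval_finsetSum] at this
  omega

open Polynomial in
/-- The `q`-analogue of the factorial of `k`. -/
noncomputable def qFactorial (k : ℕ) : ℤ[X] :=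
  ∏ j ∈ Finset.range k, qNat (j + 1)

theorem qFactorial_succ (k : ℕ) : qFactorial (k + 1) = qFactorial k * qNat (k + 1) :=
  Finset.prod_range_succ _ _

theorem qFactorial_ne_zero (k : ℕ) : qFactorial k ≠ 0 :=
  Finset.prod_ne_zero_iff.mpr fun j _ => qNat_succ_ne_zero j

open Polynomial in
theorem sum_pow_mul_qNat (d : ℕ → ℕ) (m : ℕ) :
    ∑ k ∈ Finset.Icc 1 m, X ^ (∑ j ∈ Finset.Ico 1 k, d j) * qNat (d k) =
      qNat (∑ k ∈ Finset.Icc 1 m, d k) := by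
  induction m with
  | zero => simp [qNat]
  | succ m ih =>
    rw [Finset.sum_Icc_succ_top (by omega), Finset.sum_Icc_succ_top (by omega), ih, qNat_add]
    rfl

open Polynomial in
/-- The enumerator of the words with content `d` by increasing pairs. -/
noncomputable def wordPoly (m : ℕ) (V : Finset ℕ) (d : ℕ →₀ ℕ) : ℤ[X] :=
  ∑ t ∈ tierings m V, if tierContent V t = d then X ^ upPairs V t else 0

open Polynomial in
theorem wordPoly_insert {m : ℕ} {V : Finset ℕ} {v : ℕ} (hmax : ∀ x ∈ V, x < v) (d : ℕ →₀ ℕ) :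
    wordPoly m (insert v V) d = ∑ k ∈ Finset.Icc 1 m, if d k = 0 then 0 else
      X ^ (∑ j ∈ Finset.Ico 1 k, d j) * wordPoly m V (d - Finsupp.single k 1 : ℕ →₀ ℕ) := by
  have hv : v ∉ V := fun h => lt_irrefl _ (hmax v h)
  rw [wordPoly, sum_tierings_insert hv]
  refine Finset.sum_congr rfl fun k _ => ?_
  have hoff : ∀ t : ℕ → ℕ, ∀ x ∈ V, Function.update t v k x = t x := fun t x hx =>
    Function.update_of_ne (ne_of_mem_of_not_mem hx hv) _ _
  have hcont : ∀ t : ℕ → ℕ, tierContent (insert v V) (Function.update t v k) =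
      Finsupp.single k 1 + tierContent V t := fun t => by
    rw [tierContent, Finset.sum_insert hv, Function.update_self]
    exact congrArg _ (tierContent_congr (hoff t))
  simp only [hcont]
  split_ifs with hk
  · refine Finset.sum_eq_zero fun t _ => if_neg fun h => ?_
    simp [← h] at hk
  · have hle : Finsupp.single k 1 ≤ d := by
      rw [Finsupp.single_le_iff]; omega
    rw [wordPoly, Finset.mul_sum]
    refine Finset.sum_congr rfl fun t ht => ?_
    have hiff : Finsupp.single k 1 + tierContent V t = d ↔
        tierContent V t = d - Finsupp.single k 1 :=
      ⟨fun h => by rw [← h, add_tsub_cancel_left], fun h => by rw [h, add_tsub_cancel_of_le hle]⟩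
    rw [mul_ite, mul_zero]
    refine if_ctx_congr hiff (fun h => ?_) fun _ => rfl
    rw [upPairs_insert _ hmax, upPairs_congr (hoff t), Function.update_self, add_comm, pow_add,
      Finset.filter_congr fun x hx => by rw [hoff t x hx], card_filter_lt_eq_sum_tierContent ht]
    congr 2
    refine Finset.sum_congr rfl fun j hj => ?_
    have := (Finset.mem_Ico.mp hj).2.ne'
    rw [h, Finsupp.tsub_apply, Finsupp.single_eq_of_ne (by omega), tsub_zero]

/-- MacMahon's formula for the multinomial coefficient. -/
theorem wordPoly_mul_prod_qFactorial {m : ℕ} {V : Finset ℕ} {d : ℕ →₀ ℕ}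
    (hsupp : ∀ k, k ∉ Finset.Icc 1 m → d k = 0) (hsum : ∑ k ∈ Finset.Icc 1 m, d k = V.card) :
    wordPoly m V d * ∏ k ∈ Finset.Icc 1 m, qFactorial (d k) = qFactorial V.card := by
  induction V using Finset.induction_on_max generalizing d with
  | empty =>
    have hd : d = 0 := by
      ext k
      by_cases hk : k ∈ Finset.Icc 1 m
      · exact Finset.sum_eq_zero_iff.mp hsum k hk
      · exact hsupp k hk
    subst hd
    simp [wordPoly, tierings_empty, tierContent, upPairs, qFactorial]
  | insert v V hmax ih =>
    have hv : v ∉ V := fun h => lt_irrefl _ (hmax v h)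
    rw [Finset.card_insert_of_notMem hv] at hsum ⊢
    rw [wordPoly_insert hmax, Finset.sum_mul, qFactorial_succ, ← hsum, ← sum_pow_mul_qNat,
      Finset.mul_sum]
    refine Finset.sum_congr rfl fun k hk => ?_
    split_ifs with hdk
    · simp [hdk, qNat]
    · have hoff : ∀ j, j ≠ k → (d - Finsupp.single k 1 : ℕ →₀ ℕ) j = d j := fun j hj => by
        rw [Finsupp.tsub_apply, Finsupp.single_eq_of_ne hj, tsub_zero]
      have hon : d k = (d - Finsupp.single k 1 : ℕ →₀ ℕ) k + 1 := by
        rw [Finsupp.tsub_apply, Finsupp.single_eq_same]; omega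
      have hprod : ∏ j ∈ Finset.Icc 1 m, qFactorial (d j) =
          (∏ j ∈ Finset.Icc 1 m, qFactorial ((d - Finsupp.single k 1 : ℕ →₀ ℕ) j)) * qNat (d k) := by
        rw [← Finset.mul_prod_erase _ _ hk, ← Finset.mul_prod_erase _ _ hk]
        nth_rewrite 1 [hon]
        rw [qFactorial_succ, ← hon, Finset.prod_congr rfl fun j hj => by
          rw [← hoff j (Finset.ne_of_mem_erase hj)]]
        ring
      have hsum' : ∑ j ∈ Finset.Icc 1 m, (d - Finsupp.single k 1 : ℕ →₀ ℕ) j = V.card := by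
        have herase : ∑ j ∈ (Finset.Icc 1 m).erase k, (d - Finsupp.single k 1 : ℕ →₀ ℕ) j =
            ∑ j ∈ (Finset.Icc 1 m).erase k, d j :=
          Finset.sum_congr rfl fun j hj => hoff j (Finset.ne_of_mem_erase hj)
        rw [← Finset.add_sum_erase _ _ hk] at hsum ⊢
        omega
      rw [hprod, ← ih _ hsum']
      · ring
      · intro j hj
        rw [hoff j fun h => hj (h ▸ hk), hsupp j hj]

theorem wordPoly_eq_zero {m : ℕ} {V : Finset ℕ} {d : ℕ →₀ ℕ}
    (h : ¬((∀ k, k ∉ Finset.Icc 1 m → d k = 0) ∧ ∑ k ∈ Finset.Icc 1 m, d k = V.card)) :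
    wordPoly m V d = 0 := by
  refine Finset.sum_eq_zero fun t ht => if_neg ?_
  rintro rfl
  exact h ⟨fun k hk => tierContent_eq_zero ht hk, sum_tierContent ht⟩

/-- Permuting the letters does not change the enumerator of words by increasing pairs. -/
theorem wordPoly_mapDomain {m : ℕ} {τ : Equiv.Perm ℕ}
    (hτ : ∀ k, τ k ∈ Finset.Icc 1 m ↔ k ∈ Finset.Icc 1 m) (V : Finset ℕ) (d : ℕ →₀ ℕ) :
    wordPoly m V (d.mapDomain τ) = wordPoly m V d := by
  have happly : ∀ k, d.mapDomain τ (τ k) = d k := fun k =>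
    Finsupp.mapDomain_apply τ.injective d k
  have hsupp : (∀ k, k ∉ Finset.Icc 1 m → d.mapDomain τ k = 0) ↔
      ∀ k, k ∉ Finset.Icc 1 m → d k = 0 := by
    rw [← τ.forall_congr_right]
    simp only [happly, hτ]
  have hsum : ∑ k ∈ Finset.Icc 1 m, d.mapDomain τ k = ∑ k ∈ Finset.Icc 1 m, d k :=
    (Finset.sum_equiv τ (fun k => (hτ k).symm) fun k _ => (happly k).symm).symm
  have hprod : ∏ k ∈ Finset.Icc 1 m, qFactorial (d.mapDomain τ k) =
      ∏ k ∈ Finset.Icc 1 m, qFactorial (d k) :=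
    (Finset.prod_equiv τ (fun k => (hτ k).symm) fun k _ => by rw [happly]).symm
  by_cases h : (∀ k, k ∉ Finset.Icc 1 m → d k = 0) ∧ ∑ k ∈ Finset.Icc 1 m, d k = V.card
  · refine mul_right_cancel₀
      (Finset.prod_ne_zero_iff.mpr fun k (_ : k ∈ Finset.Icc 1 m) => qFactorial_ne_zero (d k)) ?_
    rw [wordPoly_mul_prod_qFactorial h.1 h.2, ← hprod,
      wordPoly_mul_prod_qFactorial (hsupp.mpr h.1) (hsum.trans h.2)]
  · rw [wordPoly_eq_zero h, wordPoly_eq_zero]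
    rwa [hsupp, hsum]

/-! ### Symmetry of the generating functions -/

open Polynomial in
/-- The generating function of words on `V` by content and increasing pairs. -/
noncomputable def wordGenFun (m : ℕ) (V : Finset ℕ) : MvPolynomial ℕ ℤ[X] :=
  ∑ t ∈ tierings m V, MvPolynomial.monomial (tierContent V t) (X ^ upPairs V t)

open Polynomial in
/-- The generating function of tiered trees on `V` by tier type and weight. -/
noncomputable def treeGenFun (m : ℕ) (V : Finset ℕ) : MvPolynomial ℕ ℤ[X] :=
  ∑ t ∈ tierings m V, MvPolynomial.monomial (tierContent V t) (treePoly V t)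

theorem coeff_wordGenFun (m : ℕ) (V : Finset ℕ) (d : ℕ →₀ ℕ) :
    MvPolynomial.coeff d (wordGenFun m V) = wordPoly m V d := by
  rw [wordGenFun, MvPolynomial.coeff_sum, wordPoly]
  simp only [MvPolynomial.coeff_monomial]

theorem wordGenFun_empty (m : ℕ) : wordGenFun m ∅ = 1 := by
  simp [wordGenFun, tierings_empty, tierContent, upPairs]

theorem rename_wordGenFun {m : ℕ} {τ : Equiv.Perm ℕ}
    (hτ : ∀ k, τ k ∈ Finset.Icc 1 m ↔ k ∈ Finset.Icc 1 m) (V : Finset ℕ) :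
    MvPolynomial.rename τ (wordGenFun m V) = wordGenFun m V := by
  ext1 d
  obtain ⟨d, rfl⟩ : ∃ d', d = Finsupp.mapDomain τ d' :=
    ⟨d.mapDomain τ.symm, by rw [← Finsupp.mapDomain_comp]; simp⟩
  rw [MvPolynomial.coeff_rename_mapDomain _ τ.injective, coeff_wordGenFun, coeff_wordGenFun,
    wordPoly_mapDomain hτ]

open Polynomial in
theorem wordGenFun_eq_sum (m : ℕ) {V : Finset ℕ} {v : ℕ} (hv : v ∈ V) (hmin : ∀ x ∈ V, v ≤ x) :
    wordGenFun m V = ∑ C ∈ rootedSubsets V v,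
      MvPolynomial.C ((X - 1 : ℤ[X]) ^ (C.card - 1)) * (treeGenFun m C * wordGenFun m (V \ C)) := by
  have hmon : ∀ t : ℕ → ℕ, MvPolynomial.monomial (tierContent V t) ((X : ℤ[X]) ^ upPairs V t) =
      ∑ C ∈ rootedSubsets V v, MvPolynomial.C ((X - 1 : ℤ[X]) ^ (C.card - 1)) *
        (MvPolynomial.monomial (tierContent C t) (treePoly C t) *
          MvPolynomial.monomial (tierContent (V \ C) t) (X ^ upPairs (V \ C) t)) := by
    intro t
    rw [X_pow_upPairs_eq_sum t V hv hmin, map_sum]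
    refine Finset.sum_congr rfl fun C hC => ?_
    rw [MvPolynomial.monomial_mul, MvPolynomial.C_mul_monomial, mul_assoc, tierContent, tierContent,
      tierContent, add_comm, Finset.sum_sdiff (mem_rootedSubsets.mp hC).1]
  rw [wordGenFun, Finset.sum_congr rfl fun t _ => hmon t, Finset.sum_comm]
  refine Finset.sum_congr rfl fun C hC => ?_
  rw [← Finset.mul_sum, sum_tierings_mul (mem_rootedSubsets.mp hC).1]
  · rfl
  · intro t t' h
    rw [tierContent_congr h, treePoly_congr h]
  · intro t t' h
    rw [tierContent_congr h, upPairs_congr h]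

theorem rename_treeGenFun {m : ℕ} {τ : Equiv.Perm ℕ}
    (hτ : ∀ k, τ k ∈ Finset.Icc 1 m ↔ k ∈ Finset.Icc 1 m) {V : Finset ℕ} (hV : V.Nonempty) :
    MvPolynomial.rename τ (treeGenFun m V) = treeGenFun m V := by
  induction V using Finset.strongInduction with
  | H V ih =>
  obtain ⟨v, hv, hmin⟩ := exists_min hV
  have hself : V ∈ rootedSubsets V v := mem_rootedSubsets.mpr ⟨subset_rfl, hv⟩
  have h := rename_wordGenFun hτ V
  rw [wordGenFun_eq_sum m hv hmin, map_sum, ← Finset.add_sum_erase _ _ hself,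
    ← Finset.add_sum_erase _ _ hself, Finset.sum_congr rfl (g := fun C =>
      MvPolynomial.C ((Polynomial.X - 1 : Polynomial ℤ) ^ (C.card - 1)) *
        (treeGenFun m C * wordGenFun m (V \ C)))] at h
  · have h := add_right_cancel h
    rw [Finset.sdiff_self, wordGenFun_empty, mul_one, map_mul, MvPolynomial.rename_C] at h
    refine mul_left_cancel₀ ?_ h
    rw [Ne, MvPolynomial.C_eq_zero]
    exact pow_ne_zero _ (Polynomial.X_sub_C_ne_zero 1)
  · intro C hC
    obtain ⟨hCV, hC⟩ := Finset.mem_erase.mp hC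
    rw [mem_rootedSubsets] at hC
    rw [map_mul, map_mul, MvPolynomial.rename_C, rename_wordGenFun hτ,
      ih C (lt_of_le_of_ne hC.1 hCV) ⟨v, hC.2⟩]

/-! ### Counting tiered trees of a given type -/

/-- The tier type `p`, as a finitely supported function of the tier. -/
noncomputable def typeContent {m : ℕ} (p : Fin m → ℕ) : ℕ →₀ ℕ :=
  ∑ k : Fin m, Finsupp.single ((k : ℕ) + 1) (p k)

theorem typeContent_apply {m : ℕ} (p : Fin m → ℕ) (k : Fin m) :
    typeContent p ((k : ℕ) + 1) = p k := by
  rw [typeContent, Finsupp.finsetSum_apply, Finset.sum_eq_single k]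
  · simp
  · intro j _ hj
    exact Finsupp.single_eq_of_ne fun h => hj (Fin.ext (by omega))
  · simp

theorem typeContent_eq_zero {m : ℕ} (p : Fin m → ℕ) {k : ℕ} (hk : k ∉ Finset.Icc 1 m) :
    typeContent p k = 0 := by
  rw [typeContent, Finsupp.finsetSum_apply]
  refine Finset.sum_eq_zero fun j _ => Finsupp.single_eq_of_ne ?_
  rintro rfl
  exact hk (Finset.mem_Icc.mpr ⟨by omega, j.isLt⟩)

theorem tierContent_eq_typeContent_iff {n m : ℕ} (p : Fin m → ℕ) {t : ℕ → ℕ}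
    (ht : t ∈ tierings m (Finset.Icc 1 n)) :
    tierContent (Finset.Icc 1 n) t = typeContent p ↔
      ∀ k : Fin m, tierSize n t ((k : ℕ) + 1) = p k := by
  have htier : ∀ k, tierSize n t k = tierContent (Finset.Icc 1 n) t k := fun k =>
    (tierContent_apply _ _ _).symm
  simp only [htier]
  constructor
  · intro h k
    rw [h, typeContent_apply]
  · intro h
    ext k
    by_cases hk : k ∈ Finset.Icc 1 m
    · have hk' := Finset.mem_Icc.mp hk
      have := h ⟨k - 1, by omega⟩
      rw [← typeContent_apply p] at this
      simpa [Nat.sub_add_cancel hk'.1] using this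
    · rw [tierContent_eq_zero ht hk, typeContent_eq_zero p hk]

theorem coeff_treePoly (V : Finset ℕ) (t : ℕ → ℕ) (w : ℕ) :
    (treePoly V t).coeff w = ((tieredTrees V t).filter fun E => treeWeight V E t = w).card := by
  rw [treePoly, Polynomial.finsetSum_coeff, Finset.card_filter]
  push_cast
  refine Finset.sum_congr rfl fun E _ => ?_
  rw [Polynomial.coeff_X_pow]
  simp only [eq_comm]

theorem card_tieredTrees_eq_coeff (n m : ℕ) (p : Fin m → ℕ) (w : ℕ) :
    (Nat.card {T ∈ TieredTreesOfType n m p | treeWeight (Finset.Icc 1 n) T.1 T.2 = w} : ℤ) =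
      (MvPolynomial.coeff (typeContent p) (treeGenFun m (Finset.Icc 1 n))).coeff w := by
  set V := Finset.Icc 1 n
  have hset : {T ∈ TieredTreesOfType n m p | treeWeight V T.1 T.2 = w} =
      ((((tierings m V).filter fun t => tierContent V t = typeContent p).sigma fun t =>
        (tieredTrees V t).filter fun E => treeWeight V E t = w).image fun z => (z.2, z.1) :
          Finset (Finset (Sym2 ℕ) × (ℕ → ℕ))) := by
    ext ⟨E, t⟩
    simp only [TieredTreesOfType, IsTieredOn, Finset.coe_image, Set.mem_image, Finset.mem_coe,
      Finset.mem_sigma, Finset.mem_filter, mem_tieredTrees, Prod.mk.injEq, Sigma.exists]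
    constructor
    · rintro ⟨⟨hE, ⟨h1, h2⟩, h0, hp⟩, hw⟩
      have ht : t ∈ tierings m V := mem_tierings.mpr ⟨h1, h0⟩
      exact ⟨t, E, ⟨⟨ht, (tierContent_eq_typeContent_iff p ht).mpr hp⟩, ⟨hE, h2⟩, hw⟩, rfl, rfl⟩
    · rintro ⟨t, E, ⟨⟨ht, hp⟩, ⟨hE, h2⟩, hw⟩, rfl, rfl⟩
      have ht' := mem_tierings.mp ht
      exact ⟨⟨hE, ⟨ht'.1, h2⟩, ht'.2, (tierContent_eq_typeContent_iff p ht).mp hp⟩, hw⟩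
  rw [hset, Nat.card_coe_set_eq, Set.ncard_coe_finset, Finset.card_image_of_injective,
    Finset.card_sigma, treeGenFun, MvPolynomial.coeff_sum, Polynomial.finsetSum_coeff,
    Finset.sum_filter]
  · push_cast
    refine Finset.sum_congr rfl fun t _ => ?_
    rw [MvPolynomial.coeff_monomial]
    split_ifs
    · rw [coeff_treePoly]
    · simp
  · rintro ⟨t, E⟩ ⟨t', E'⟩ h
    simp only [Prod.mk.injEq] at h
    obtain ⟨rfl, rfl⟩ := h
    rfl

/-- If the compositions `p` and `p'` of `n` into `m` parts are
rearrangements of each other, then `Σ_{T ∈ 𝒯_p} q^{w(T)} = Σ_{T ∈ 𝒯_{p'}} q^{w(T)}`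
as polynomials in `q`; equivalently, for every `w` the number of properly tiered
trees of type `p` and weight `w` equals the number of those of type `p'` and weight `w`. -/
theorem tier_type_rearrangement_weight_generating_function
    (n m : ℕ) (hn : 1 ≤ n) (hm : 2 ≤ m)
    (p p' : Fin m → ℕ) (hp : ∑ k, p k = n) (hppos : ∀ k, 1 ≤ p k)
    (hperm : ∃ σ : Equiv.Perm (Fin m), ∀ k, p' k = p (σ k)) :
    ∀ w : ℕ,
      Nat.card {T ∈ TieredTreesOfType n m p | treeWeight (Finset.Icc 1 n) T.1 T.2 = w}
        = Nat.card {T ∈ TieredTreesOfType n m p' |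
            treeWeight (Finset.Icc 1 n) T.1 T.2 = w} := by
  obtain ⟨σ, hσ⟩ := hperm
  intro w
  let ι : Fin m ↪ ℕ := ⟨fun k => (k : ℕ) + 1, fun a b h => Fin.ext (by simpa using h)⟩
  let τ : Equiv.Perm ℕ := Equiv.Perm.viaEmbedding σ.symm ι
  have hιmem : ∀ k : Fin m, ι k ∈ Finset.Icc 1 m := fun k =>
    Finset.mem_Icc.mpr ⟨Nat.succ_pos _, k.isLt⟩
  have hι : ∀ k, k ∈ Finset.Icc 1 m → ∃ j : Fin m, ι j = k := by
    intro k hk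
    rw [Finset.mem_Icc] at hk
    exact ⟨⟨k - 1, by omega⟩, Nat.sub_add_cancel hk.1⟩
  have hτι : ∀ k, τ (ι k) = ι (σ.symm k) := fun k => Equiv.Perm.viaEmbedding_apply _ _ _
  have hτ : ∀ k, τ k ∈ Finset.Icc 1 m ↔ k ∈ Finset.Icc 1 m := by
    intro k
    by_cases hk : k ∈ Finset.Icc 1 m
    · obtain ⟨j, rfl⟩ := hι k hk
      rw [hτι]
      exact iff_of_true (hιmem _) hk
    · have : τ k = k := Equiv.Perm.viaEmbedding_apply_of_notMem _ _ _ (by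
        rintro ⟨j, rfl⟩; exact hk (hιmem j))
      rw [this]
  have htype : typeContent p' = (typeContent p).mapDomain τ := by
    rw [typeContent, typeContent, Finsupp.mapDomain_finsetSum]
    refine Finset.sum_equiv σ (by simp) fun k _ => ?_
    rw [Finsupp.mapDomain_single, hσ]
    have := hτι (σ k)
    rw [Equiv.symm_apply_apply] at this
    exact congrArg (Finsupp.single · _) this.symm
  have hV : (Finset.Icc 1 n).Nonempty := ⟨1, Finset.mem_Icc.mpr ⟨le_rfl, hn⟩⟩
  have hcoeff := MvPolynomial.coeff_rename_mapDomain τ τ.injective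
    (treeGenFun m (Finset.Icc 1 n)) (typeContent p)
  rw [rename_treeGenFun hτ hV, ← htype] at hcoeff
  have h := card_tieredTrees_eq_coeff n m p w
  rw [← hcoeff, ← card_tieredTrees_eq_coeff n m p' w] at h
  exact_mod_cast h
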